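/- (Theorem B(a)) Let u be a weak stationary solution density and let U be an anti-Lyapunov function in 𝒰 with respect to ℒ with anti-Lyapunov constant γ > 0, essential lower bound ρ_m and essential upper bound ρ_M. Let H be an upper sandwich function for U with H(t) > 0 for all t ∈ [ρ_m, ρ_M), and assume condition (R): for Lebesgue-a.e. ρ ∈ [ρ_m, ρ_M), ∇U(x) ≠ 0 for every x ∈ U^{-1}(ρ). Set Ω*_{ρ_m} = Ω_{ρ_m} ∪ U^{-1}(ρ_m) = {x ∈ 𝒰 : U(x) ≤ ρ_m}. Then for every ρ_0 ∈ (ρ_m, ρ_M) and every ρ ∈ (ρ_0, ρ_M), μ(Ω_ρ \ Ω*_{ρ_m}) ≥ μ(Ω_{ρ_0} \ Ω*_{ρ_m}) · exp(γ ∫_{ρ_0}^{ρ} dt / H(t)). -/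

import Mathlib

open MeasureTheory

noncomputable section

/-- Euclidean space ℝⁿ. -/
abbrev Eucl (n : ℕ) : Type := EuclideanSpace ℝ (Fin n)

/-- First-order partial derivative `∂ᵢ f`. -/
def pd {n : ℕ} (f : Eucl n → ℝ) (i : Fin n) (x : Eucl n) : ℝ :=
  fderiv ℝ f x (EuclideanSpace.single i 1)

/-- Second-order partial derivative `∂²ᵢⱼ f`. -/
def pd2 {n : ℕ} (f : Eucl n → ℝ) (i j : Fin n) (x : Eucl n) : ℝ :=
  fderiv ℝ (fun y => fderiv ℝ f y (EuclideanSpace.single j 1)) x (EuclideanSpace.single i 1)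

/-- The adjoint Fokker–Planck operator `ℒf = aⁱʲ ∂²ᵢⱼ f + Vⁱ ∂ᵢ f`. -/
def Lop {n : ℕ} (a : Eucl n → Matrix (Fin n) (Fin n) ℝ)
    (V : Eucl n → Fin n → ℝ) (f : Eucl n → ℝ) (x : Eucl n) : ℝ :=
  (∑ i, ∑ j, a x i j * pd2 f i j x) + ∑ i, V x i * pd f i x

/-- The quadratic form `⟨a(x) ∇f(x), ∇f(x)⟩ = ∑ᵢⱼ aⁱʲ ∂ᵢf ∂ⱼf`. -/
def aQuad {n : ℕ} (a : Eucl n → Matrix (Fin n) (Fin n) ℝ)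
    (f : Eucl n → ℝ) (x : Eucl n) : ℝ :=
  ∑ i, ∑ j, a x i j * pd f i x * pd f j x


open Set Filter Topology Metric ContinuousLinearMap
open scoped ContDiff Convolution

section Mollification

variable {n : ℕ}

theorem continuousOn_pd {f : Eucl n → ℝ} {s : Set (Eucl n)} (hs : IsOpen s)
    (hf : ContDiffOn ℝ 1 f s) (i : Fin n) : ContinuousOn (pd f i) s :=
  (hf.continuousOn_fderiv_of_isOpen hs le_rfl).clm_apply continuousOn_const

theorem contDiffOn_pd {f : Eucl n → ℝ} {s : Set (Eucl n)} (hs : IsOpen s)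
    (hf : ContDiffOn ℝ 2 f s) (i : Fin n) : ContDiffOn ℝ 1 (pd f i) s :=
  (hf.fderiv_of_isOpen hs (by norm_num)).clm_apply contDiffOn_const

theorem pd2_eq_pd_pd (f : Eucl n → ℝ) (i j : Fin n) : pd2 f i j = pd (pd f j) i := rfl

theorem continuousOn_Lop {a : Eucl n → Matrix (Fin n) (Fin n) ℝ} {V : Eucl n → Fin n → ℝ}
    {f : Eucl n → ℝ} {s : Set (Eucl n)} (hs : IsOpen s)
    (ha : ∀ i j, ContinuousOn (fun x => a x i j) s) (hV : ContinuousOn V s)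
    (hf : ContDiffOn ℝ 2 f s) : ContinuousOn (Lop a V f) s := by
  have hVi (i : Fin n) : ContinuousOn (fun x => V x i) s := continuousOn_pi.1 hV i
  refine ContinuousOn.add ?_ ?_
  · refine continuousOn_finsetSum _ fun i _ => continuousOn_finsetSum _ fun j _ => ?_
    exact (ha i j).mul (continuousOn_pd hs (contDiffOn_pd hs hf j) i)
  · exact continuousOn_finsetSum _ fun i _ =>
      (hVi i).mul (continuousOn_pd hs (hf.of_le (by norm_num)) i)

theorem pd_congr {f g : Eucl n → ℝ} {x : Eucl n} (h : f =ᶠ[𝓝 x] g) (i : Fin n) :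
    pd f i =ᶠ[𝓝 x] pd g i :=
  (h.fderiv (𝕜 := ℝ)).mono fun y hy => by simp only [pd, hy]

theorem Lop_congr {a : Eucl n → Matrix (Fin n) (Fin n) ℝ} {V : Eucl n → Fin n → ℝ}
    {f g : Eucl n → ℝ} {x : Eucl n} (h : f =ᶠ[𝓝 x] g) : Lop a V f x = Lop a V g x := by
  simp only [Lop, pd2_eq_pd_pd, fun i => (pd_congr h i).eq_of_nhds,
    fun i j => (pd_congr (pd_congr h j) i).eq_of_nhds]

theorem Lop_eq_zero_of_notMem_tsupport {a : Eucl n → Matrix (Fin n) (Fin n) ℝ}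
    {V : Eucl n → Fin n → ℝ} {f : Eucl n → ℝ} {x : Eucl n} (h : x ∉ tsupport f) :
    Lop a V f x = 0 := by
  rw [Lop_congr (notMem_tsupport_iff_eventuallyEq.1 h)]
  have h1 (i : Fin n) : pd (0 : Eucl n → ℝ) i = 0 := by
    ext y
    simp [pd]
  simp [Lop, pd2_eq_pd_pd, h1]

theorem HasCompactSupport.pd {f : Eucl n → ℝ} (hf : HasCompactSupport f) (i : Fin n) :
    HasCompactSupport (pd f i) :=
  hf.fderiv_apply ℝ _

theorem pd_normed_convolution (φ : ContDiffBump (0 : Eucl n)) {g : Eucl n → ℝ}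
    (hg : ContDiff ℝ 1 g) (hgc : HasCompactSupport g) (i : Fin n) :
    pd (φ.normed volume ⋆[lsmul ℝ ℝ, volume] g) i =
      φ.normed volume ⋆[lsmul ℝ ℝ, volume] pd g i := by
  have hφ : LocallyIntegrable (φ.normed (volume : Measure (Eucl n))) volume :=
    φ.continuous_normed.locallyIntegrable
  ext x
  rw [pd, (hgc.hasFDerivAt_convolution_right (lsmul ℝ ℝ) hφ hg x).fderiv]
  exact convolution_precompR_apply _ hφ (hgc.fderiv ℝ) (hg.continuous_fderiv one_ne_zero) x _

theorem abs_normed_convolution_le (φ : ContDiffBump (0 : Eucl n)) {g : Eucl n → ℝ}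
    (hg : Continuous g) {C : ℝ} (hC : ∀ x, |g x| ≤ C) (x : Eucl n) :
    |(φ.normed volume ⋆[lsmul ℝ ℝ, volume] g) x| ≤ 3 * C := by
  have h : dist ((φ.normed volume ⋆[lsmul ℝ ℝ, volume] g) x) (g x) ≤ 2 * C := by
    refine φ.dist_normed_convolution_le hg.aestronglyMeasurable fun y _ => ?_
    rw [Real.dist_eq]
    linarith [abs_sub (g y) (g x), hC y, hC x]
  rw [Real.dist_eq] at h
  have := abs_sub_abs_le_abs_sub ((φ.normed volume ⋆[lsmul ℝ ℝ, volume] g) x) (g x)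
  linarith [hC x]

/-- Stationarity against smooth test functions extends to `C²` test functions. -/
theorem integral_Lop_mul_eq_zero_of_contDiff_two {𝒰 : Set (Eucl n)} (hUopen : IsOpen 𝒰)
    {a : Eucl n → Matrix (Fin n) (Fin n) ℝ} {V : Eucl n → Fin n → ℝ} {u : Eucl n → ℝ}
    (ha : ∀ i j, ContinuousOn (fun x => a x i j) 𝒰) (hV : ContinuousOn V 𝒰)
    (hu : ContinuousOn u 𝒰)
    (hu_stat : ∀ f : Eucl n → ℝ, ContDiff ℝ (⊤ : ℕ∞) f → HasCompactSupport f →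
      tsupport f ⊆ 𝒰 → (∫ x in 𝒰, Lop a V f x * u x) = 0)
    {f : Eucl n → ℝ} (hf : ContDiff ℝ 2 f) (hfc : HasCompactSupport f) (hfs : tsupport f ⊆ 𝒰) :
    (∫ x in 𝒰, Lop a V f x * u x) = 0 := by
  have hVi (i : Fin n) : ContinuousOn (fun x => V x i) 𝒰 := continuousOn_pi.1 hV i
  obtain ⟨δ, hδ, hδs⟩ := IsCompact.exists_cthickening_subset_open hfc hUopen hfs
  set K := cthickening δ (tsupport f) with hK
  have hKc : IsCompact K := IsCompact.cthickening hfc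
  let φ (k : ℕ) : ContDiffBump (0 : Eucl n) :=
    ⟨δ / (k + 2) / 2, δ / (k + 2), by positivity, half_lt_self (by positivity)⟩
  have hφ0 : Tendsto (fun k => (φ k).rOut) atTop (𝓝 0) := by
    have := (tendsto_const_div_atTop_nhds_zero_nat δ).comp (tendsto_add_atTop_nat 2)
    refine this.congr fun k => ?_
    simp [φ]
  have hφδ (k : ℕ) : (φ k).rOut ≤ δ := by
    refine div_le_self hδ.le ?_
    have : (0 : ℝ) ≤ k := k.cast_nonneg
    linarith
  let F (k : ℕ) : Eucl n → ℝ := (φ k).normed volume ⋆[lsmul ℝ ℝ, volume] f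
  have hf1 : ContDiff ℝ 1 f := hf.of_le (by norm_num)
  have hpd1 (i : Fin n) : ContDiff ℝ 1 (pd f i) :=
    contDiffOn_univ.1 (contDiffOn_pd isOpen_univ hf.contDiffOn i)
  have hpd2 (i j : Fin n) : Continuous (pd2 f i j) :=
    continuousOn_univ.1 (continuousOn_pd isOpen_univ (hpd1 j).contDiffOn i)
  have hFpd (k : ℕ) (i : Fin n) :
      pd (F k) i = (φ k).normed volume ⋆[lsmul ℝ ℝ, volume] pd f i :=
    pd_normed_convolution (φ k) hf1 hfc i
  have hFpd2 (k : ℕ) (i j : Fin n) :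
      pd2 (F k) i j = (φ k).normed volume ⋆[lsmul ℝ ℝ, volume] pd2 f i j := by
    rw [pd2_eq_pd_pd, hFpd, pd_normed_convolution (φ k) (hpd1 j) (hfc.pd j) i, pd2_eq_pd_pd]
  have hFsm (k : ℕ) : ContDiff ℝ (⊤ : ℕ∞) (F k) :=
    (φ k).hasCompactSupport_normed.contDiff_convolution_left _ (φ k).contDiff_normed
      hf.continuous.locallyIntegrable
  have hFK (k : ℕ) : tsupport (F k) ⊆ K := by
    refine closure_minimal ?_ isClosed_cthickening
    refine (support_convolution_subset _).trans ?_
    rintro _ ⟨y, hy, z, hz, rfl⟩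
    rw [(φ k).support_normed_eq, mem_ball_zero_iff] at hy
    refine mem_cthickening_of_dist_le (y + z) z δ _ (subset_tsupport _ hz) ?_
    simpa [dist_eq_norm] using hy.le.trans (hφδ k)
  have hFc (k : ℕ) : HasCompactSupport (F k) := hKc.of_isClosed_subset (isClosed_tsupport _) (hFK k)
  choose C hC using fun i => (hpd1 i).continuous.bounded_above_of_compact_support (hfc.pd i)
  choose D hD using fun i j =>
    (hpd2 i j).bounded_above_of_compact_support ((hfc.pd j).pd i)
  let B (x : Eucl n) : ℝ :=
    ((∑ i, ∑ j, |a x i j| * (3 * D i j)) + ∑ i, |V x i| * (3 * C i)) * |u x|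
  have hBcont : ContinuousOn B 𝒰 := by
    refine ContinuousOn.mul (ContinuousOn.add ?_ ?_) hu.abs
    · exact continuousOn_finsetSum _ fun i _ => continuousOn_finsetSum _ fun j _ =>
        (ha i j).abs.mul continuousOn_const
    · exact continuousOn_finsetSum _ fun i _ => (hVi i).abs.mul continuousOn_const
  have hBint : Integrable (K.indicator B) (volume.restrict 𝒰) :=
    (((hBcont.mono hδs).integrableOn_compact hKc).integrable_indicator
      hKc.measurableSet).integrableOn
  have hlim := tendsto_integral_of_dominated_convergence (μ := volume.restrict 𝒰)
    (F := fun k x => Lop a V (F k) x * u x) (f := fun x => Lop a V f x * u x) (K.indicator B)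
    (fun k => ((continuousOn_Lop hUopen ha hV (contDiff_infty.1 (hFsm k) 2).contDiffOn).mul
      hu).aestronglyMeasurable hUopen.measurableSet) hBint
    (fun k => Eventually.of_forall fun x => ?_) (Eventually.of_forall fun x => ?_)
  · refine tendsto_nhds_unique hlim (tendsto_const_nhds.congr fun k => ?_)
    exact (hu_stat (F k) (hFsm k) (hFc k) ((hFK k).trans hδs)).symm
  · by_cases hx : x ∈ K
    · rw [indicator_of_mem hx, norm_mul, Real.norm_eq_abs, Real.norm_eq_abs]
      refine mul_le_mul_of_nonneg_right ?_ (abs_nonneg _)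
      refine (abs_add_le _ _).trans (add_le_add ?_ ?_)
      · refine (Finset.abs_sum_le_sum_abs _ _).trans (Finset.sum_le_sum fun i _ => ?_)
        refine (Finset.abs_sum_le_sum_abs _ _).trans (Finset.sum_le_sum fun j _ => ?_)
        rw [abs_mul, hFpd2]
        exact mul_le_mul_of_nonneg_left (abs_normed_convolution_le _ (hpd2 i j) (hD i j) x)
          (abs_nonneg _)
      · refine (Finset.abs_sum_le_sum_abs _ _).trans (Finset.sum_le_sum fun i _ => ?_)
        rw [abs_mul, hFpd]
        exact mul_le_mul_of_nonneg_left
          (abs_normed_convolution_le _ (hpd1 i).continuous (hC i) x) (abs_nonneg _)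
    · rw [indicator_of_notMem hx, Lop_eq_zero_of_notMem_tsupport fun h => hx (hFK k h)]
      simp
  · refine Tendsto.mul_const _ (Tendsto.add ?_ ?_)
    · refine tendsto_finsetSum _ fun i _ => tendsto_finsetSum _ fun j _ => ?_
      refine Tendsto.const_mul _ ?_
      simp only [hFpd2]
      exact ContDiffBump.convolution_tendsto_right_of_continuous hφ0 (hpd2 i j) x
    · refine tendsto_finsetSum _ fun i _ => Tendsto.const_mul _ ?_
      simp only [hFpd]
      exact ContDiffBump.convolution_tendsto_right_of_continuous hφ0 (hpd1 i).continuous x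

end Mollification

section Composition

variable {n : ℕ}

theorem pd_comp {φ : ℝ → ℝ} {U : Eucl n → ℝ} {x : Eucl n} {c : ℝ} (hφ : HasDerivAt φ c (U x))
    (hU : DifferentiableAt ℝ U x) (i : Fin n) : pd (fun y => φ (U y)) i x = c * pd U i x := by
  have h := hφ.comp_hasFDerivAt x hU.hasFDerivAt
  simp only [pd]
  rw [show (fun y => φ (U y)) = φ ∘ U from rfl, h.fderiv]
  rfl

theorem pd_mul {f g : Eucl n → ℝ} {x : Eucl n} (hf : DifferentiableAt ℝ f x)
    (hg : DifferentiableAt ℝ g x) (i : Fin n) :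
    pd (fun y => f y * g y) i x = f x * pd g i x + g x * pd f i x := by
  simp only [pd]
  rw [fderiv_fun_mul hf hg]
  rfl

theorem Lop_comp {a : Eucl n → Matrix (Fin n) (Fin n) ℝ} {V : Eucl n → Fin n → ℝ}
    {𝒰 : Set (Eucl n)} (hUopen : IsOpen 𝒰) {U : Eucl n → ℝ} (hU : ContDiffOn ℝ 2 U 𝒰)
    {φ ψ ζ : ℝ → ℝ} (hφ : ∀ t, HasDerivAt φ (ψ t) t) (hψ : ∀ t, HasDerivAt ψ (ζ t) t)
    {x : Eucl n} (hx : x ∈ 𝒰) :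
    Lop a V (fun y => φ (U y)) x = ψ (U x) * Lop a V U x + ζ (U x) * aQuad a U x := by
  have hUd {y : Eucl n} (hy : y ∈ 𝒰) : DifferentiableAt ℝ U y :=
    (hU.contDiffAt (hUopen.mem_nhds hy)).differentiableAt (by norm_num)
  have h1 (i : Fin n) : pd (fun y => φ (U y)) i =ᶠ[𝓝 x] fun y => ψ (U y) * pd U i y := by
    filter_upwards [hUopen.mem_nhds hx] with y hy using pd_comp (hφ _) (hUd hy) i
  have h2 (i j : Fin n) : pd2 (fun y => φ (U y)) i j x =
      ψ (U x) * pd2 U i j x + ζ (U x) * (pd U i x * pd U j x) := by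
    have hdU : DifferentiableAt ℝ (pd U j) x :=
      ((contDiffOn_pd hUopen hU j).contDiffAt (hUopen.mem_nhds hx)).differentiableAt (by norm_num)
    have hdψ : DifferentiableAt ℝ (fun y => ψ (U y)) x :=
      (hψ (U x)).differentiableAt.comp x (hUd hx)
    rw [pd2_eq_pd_pd, (pd_congr (h1 j) i).eq_of_nhds, pd_mul hdψ hdU i,
      pd_comp (hψ _) (hUd hx) i, pd2_eq_pd_pd]
    ring
  simp only [Lop, aQuad, h2, fun i => (h1 i).eq_of_nhds, mul_add, Finset.mul_sum,
    Finset.sum_add_distrib]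
  rw [add_right_comm]
  congr 1
  · congr 1
    · exact Finset.sum_congr rfl fun i _ => Finset.sum_congr rfl fun j _ => by ring
    · exact Finset.sum_congr rfl fun i _ => by ring
  · exact Finset.sum_congr rfl fun i _ => Finset.sum_congr rfl fun j _ => by ring

/-- Stationarity tested against `φ ∘ U`, where `φ` is `C²` and vanishes on `[β, ∞)`. -/
theorem integral_comp_eq_zero {𝒰 : Set (Eucl n)} (hUopen : IsOpen 𝒰)
    {a : Eucl n → Matrix (Fin n) (Fin n) ℝ} {V : Eucl n → Fin n → ℝ} {u : Eucl n → ℝ}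
    (ha : ∀ i j, ContinuousOn (fun x => a x i j) 𝒰) (hV : ContinuousOn V 𝒰)
    (hu : ContinuousOn u 𝒰)
    (hu_stat : ∀ f : Eucl n → ℝ, ContDiff ℝ (⊤ : ℕ∞) f → HasCompactSupport f →
      tsupport f ⊆ 𝒰 → (∫ x in 𝒰, Lop a V f x * u x) = 0)
    {U : Eucl n → ℝ} (hU : ContDiffOn ℝ 2 U 𝒰) {β : ℝ} (hβ : IsCompact {x ∈ 𝒰 | U x ≤ β})
    {φ ψ ζ : ℝ → ℝ} (hφ : ∀ t, HasDerivAt φ (ψ t) t) (hψ : ∀ t, HasDerivAt ψ (ζ t) t)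
    (hζ : Continuous ζ) (hφβ : ∀ t, β ≤ t → φ t = 0) :
    IntegrableOn (fun x => (ψ (U x) * Lop a V U x + ζ (U x) * aQuad a U x) * u x) 𝒰 ∧
      ∫ x in 𝒰, (ψ (U x) * Lop a V U x + ζ (U x) * aQuad a U x) * u x = 0 := by
  have hφ2 : ContDiff ℝ 2 φ := by
    have hψ1 : ContDiff ℝ 1 ψ := by
      rw [contDiff_one_iff_deriv, funext fun t => (hψ t).deriv]
      exact ⟨fun t => (hψ t).differentiableAt, hζ⟩
    rw [show (2 : WithTop ℕ∞) = 1 + 1 by norm_num, contDiff_succ_iff_deriv,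
      funext fun t => (hφ t).deriv]
    exact ⟨fun t => (hφ t).differentiableAt, by simp, hψ1⟩
  set K := {x ∈ 𝒰 | U x ≤ β}
  set f : Eucl n → ℝ := 𝒰.indicator fun x => φ (U x) with hf
  have hfK : tsupport f ⊆ K := by
    refine closure_minimal (fun x hx => ?_) hβ.isClosed
    have hx𝒰 : x ∈ 𝒰 := by
      by_contra h
      exact hx (indicator_of_notMem h _)
    refine ⟨hx𝒰, ?_⟩
    by_contra! h
    exact hx ((indicator_of_mem hx𝒰 _).trans (hφβ _ h.le))
  have hK𝒰 : K ⊆ 𝒰 := fun x hx => hx.1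
  have hfeq {x : Eucl n} (hx : x ∈ 𝒰) : f =ᶠ[𝓝 x] fun y => φ (U y) := by
    filter_upwards [hUopen.mem_nhds hx] with y hy using indicator_of_mem hy _
  have hf2 : ContDiff ℝ 2 f := by
    refine contDiff_iff_contDiffAt.2 fun x => ?_
    by_cases hx : x ∈ 𝒰
    · exact (hφ2.contDiffAt.comp x (hU.contDiffAt (hUopen.mem_nhds hx))).congr_of_eventuallyEq
        (hfeq hx)
    · exact contDiffAt_const.congr_of_eventuallyEq
        (notMem_tsupport_iff_eventuallyEq.1 fun h => hx (hK𝒰 (hfK h)))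
  have hLop : EqOn (fun x => Lop a V f x * u x)
      (fun x => (ψ (U x) * Lop a V U x + ζ (U x) * aQuad a U x) * u x) 𝒰 := fun x hx => by
    simp only [Lop_congr (hfeq hx), Lop_comp hUopen hU hφ hψ hx]
  have hint : IntegrableOn (fun x => Lop a V f x * u x) 𝒰 := by
    refine IntegrableOn.of_forall_sdiff_eq_zero (s := K) ?_ hUopen.measurableSet fun x hx => ?_
    · exact (((continuousOn_Lop hUopen ha hV hf2.contDiffOn).mul hu).mono
        hK𝒰).integrableOn_compact hβ
    · simp only [Lop_eq_zero_of_notMem_tsupport fun h => hx.2 (hfK h), zero_mul]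
  refine ⟨hint.congr_fun hLop hUopen.measurableSet, ?_⟩
  rw [← setIntegral_congr_fun hUopen.measurableSet hLop]
  exact integral_Lop_mul_eq_zero_of_contDiff_two hUopen ha hV hu hu_stat hf2
    (hβ.of_isClosed_subset (isClosed_tsupport _) hfK) (hfK.trans hK𝒰)

end Composition

section OneDimensional

theorem exists_primitive_of_support_subset_Ioo {w : ℝ → ℝ} {p q : ℝ} (hpq : p ≤ q)
    (hw : Continuous w) (hw0 : ∀ t, 0 ≤ w t) (hws : ∀ t, t ∉ Ioo p q → w t = 0) :
    ∃ W : ℝ → ℝ, (∀ t, HasDerivAt W (w t) t) ∧ (∀ t, t ≤ p → W t = 0) ∧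
      (∀ t, q ≤ t → W t = ∫ r, w r) ∧ ∀ t, 0 ≤ W t ∧ W t ≤ ∫ r, w r := by
  let W (t : ℝ) : ℝ := ∫ r in p..t, w r
  have hW (t : ℝ) : HasDerivAt W (w t) t :=
    intervalIntegral.integral_hasDerivAt_right (hw.intervalIntegrable _ _)
      hw.aestronglyMeasurable.stronglyMeasurableAtFilter hw.continuousAt
  have hp (t : ℝ) (ht : t ≤ p) : W t = 0 := by
    refine intervalIntegral.integral_zero_ae (Eventually.of_forall fun r hr => hws r fun h => ?_)
    rw [uIoc_of_ge ht] at hr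
    exact h.1.not_ge hr.2
  have hq (t : ℝ) (ht : q ≤ t) : W t = ∫ r, w r := by
    simp only [W]
    rw [intervalIntegral.integral_of_le (hpq.trans ht)]
    exact setIntegral_eq_integral_of_forall_compl_eq_zero fun r hr =>
      hws r fun h => hr ⟨h.1, h.2.le.trans ht⟩
  have hmono : Monotone W :=
    monotone_of_deriv_nonneg (fun t => (hW t).differentiableAt) fun t => (hW t).deriv ▸ hw0 t
  refine ⟨W, hW, hp, hq, fun t => ⟨?_, ?_⟩⟩
  · rw [← hp _ (min_le_left p t)]
    exact hmono (min_le_right p t)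
  · rw [← hq _ (le_max_left q t)]
    exact hmono (le_max_right q t)

theorem measure_le_of_forall_integral_le {μ ν : Measure ℝ} [IsFiniteMeasure μ]
    [IsFiniteMeasure ν] {I : Set ℝ} (hI : IsOpen I) (hμ : μ Iᶜ = 0)
    (h : ∀ w : ℝ → ℝ, Continuous w → (∀ t, 0 ≤ w t) → (∀ t, t ∉ I → w t = 0) →
      ∫ t, w t ∂μ ≤ ∫ t, w t ∂ν) : μ ≤ ν := by
  have hopen (O : Set ℝ) (hO : IsOpen O) : μ O ≤ ν O := by
    have hOI : IsOpen (O ∩ I) := hO.inter hI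
    have hμO : μ O = μ (O ∩ I) := by
      refine le_antisymm ?_ (measure_mono inter_subset_left)
      calc μ O ≤ μ ((O ∩ I) ∪ Iᶜ) := measure_mono fun x hx => by
            by_cases hxI : x ∈ I
            · exact Or.inl ⟨hx, hxI⟩
            · exact Or.inr hxI
        _ ≤ μ (O ∩ I) + μ Iᶜ := measure_union_le _ _
        _ = μ (O ∩ I) := by rw [hμ, add_zero]
    rw [hμO, hOI.measure_eq_iSup_isCompact]
    refine iSup₂_le fun K hK => iSup_le fun hKc => ?_
    obtain ⟨f, hf1, hf0, -, hf⟩ := exists_continuous_one_zero_of_isCompact hKc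
      hOI.isClosed_compl (disjoint_compl_right_iff_subset.2 hK)
    have hint (m : Measure ℝ) [IsFiniteMeasure m] : Integrable f m :=
      Integrable.of_bound f.continuous.aestronglyMeasurable 1 (Eventually.of_forall fun t => by
        rw [Real.norm_eq_abs, abs_of_nonneg (hf t).1]
        exact (hf t).2)
    have h1 : μ.real K ≤ ∫ t, f t ∂μ := by
      rw [← integral_indicator_one hKc.measurableSet]
      refine integral_mono ((integrable_const 1).indicator hKc.measurableSet) (hint μ) fun t => ?_
      by_cases ht : t ∈ K
      · simp [ht, hf1 ht]
      · simpa [ht] using (hf t).1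
    have h2 : ∫ t, f t ∂ν ≤ ν.real (O ∩ I) := by
      rw [← integral_indicator_one hOI.measurableSet]
      refine integral_mono (hint ν) ((integrable_const 1).indicator hOI.measurableSet) fun t => ?_
      by_cases ht : t ∈ O ∩ I
      · rw [indicator_of_mem ht]
        exact (hf t).2
      · rw [indicator_of_notMem ht]
        exact (hf0 ht).le
    have h3 := h f f.continuous (fun t => (hf t).1) fun t ht => hf0 fun htO => ht htO.2
    have h4 := (h1.trans h3).trans h2
    calc μ K ≤ ν (O ∩ I) := by
          rwa [measureReal_def, measureReal_def,
            ENNReal.toReal_le_toReal (measure_ne_top _ _) (measure_ne_top _ _)] at h4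
      _ ≤ ν O := measure_mono inter_subset_left
  refine Measure.le_iff'.2 fun s => ?_
  rw [s.measure_eq_iInf_isOpen ν]
  exact le_iInf₂ fun O hsO => le_iInf fun hO => (measure_mono hsO).trans (hopen O hO)

theorem mul_integral_one_div_le {ν : Measure ℝ} [IsFiniteMeasure ν] {H : ℝ → ℝ}
    (hHm : Measurable H) {p q c M : ℝ} (hc : 0 ≤ c) (hH0 : ∀ t ∈ Ioo p q, 0 < H t)
    (hHM : ∀ t ∈ Ioo p q, H t ≤ M)
    (h : ∀ w : ℝ → ℝ, Continuous w → (∀ t, 0 ≤ w t) → (∀ t, t ∉ Ioo p q → w t = 0) →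
      c * ∫ t, w t ≤ ∫ t, w t * H t ∂ν) :
    c * ∫ t in Ioo p q, 1 / H t ≤ ν.real (Ioo p q) := by
  have hIm : MeasurableSet (Ioo p q) := measurableSet_Ioo
  have hHo : Measurable fun t => ENNReal.ofReal (H t) := hHm.ennreal_ofReal
  let μ₁ : Measure ℝ := ENNReal.ofReal c • volume.restrict (Ioo p q)
  let μ₂ : Measure ℝ := (ν.restrict (Ioo p q)).withDensity fun t => ENNReal.ofReal (H t)
  have : IsFiniteMeasure μ₁ := Measure.smul_finite _ ENNReal.ofReal_ne_top
  have : IsFiniteMeasure μ₂ := by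
    refine isFiniteMeasure_withDensity (ne_of_lt ?_)
    calc ∫⁻ t in Ioo p q, ENNReal.ofReal (H t) ∂ν
        ≤ ∫⁻ _ in Ioo p q, ENNReal.ofReal M ∂ν :=
          setLIntegral_mono measurable_const fun t ht => ENNReal.ofReal_le_ofReal (hHM t ht)
      _ < ⊤ := by
          rw [setLIntegral_const]
          exact ENNReal.mul_lt_top ENNReal.ofReal_lt_top (measure_lt_top _ _)
  have hle : μ₁ ≤ μ₂ := by
    refine measure_le_of_forall_integral_le (I := Ioo p q) isOpen_Ioo ?_
      fun w hw hw0 hws => ?_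
    · simp [μ₁, Measure.restrict_apply hIm.compl]
    · have e1 : ∫ t, w t ∂μ₁ = c * ∫ t, w t := by
        rw [integral_smul_measure, ENNReal.toReal_ofReal hc,
          setIntegral_eq_integral_of_forall_compl_eq_zero hws, smul_eq_mul]
      have e2 : ∫ t, w t ∂μ₂ = ∫ t, w t * H t ∂ν := by
        rw [integral_withDensity_eq_integral_toReal_smul hHo
          (Eventually.of_forall fun _ => ENNReal.ofReal_lt_top),
          ← setIntegral_eq_integral_of_forall_compl_eq_zero (s := Ioo p q)
            (f := fun t => w t * H t) fun t ht => by rw [hws t ht, zero_mul]]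
        refine setIntegral_congr_fun hIm fun t ht => ?_
        simp only [smul_eq_mul, ENNReal.toReal_ofReal (hH0 t ht).le, mul_comm]
      rw [e1, e2]
      exact h w hw hw0 hws
  have hlint : ENNReal.ofReal c * ∫⁻ t in Ioo p q, ENNReal.ofReal (1 / H t) ≤ ν (Ioo p q) := by
    calc ENNReal.ofReal c * ∫⁻ t in Ioo p q, ENNReal.ofReal (1 / H t)
        = ∫⁻ t, ENNReal.ofReal (1 / H t) ∂μ₁ := by rw [lintegral_smul_measure, smul_eq_mul]
      _ ≤ ∫⁻ t, ENNReal.ofReal (1 / H t) ∂μ₂ := lintegral_mono' hle le_rfl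
      _ = ∫⁻ t in Ioo p q, ENNReal.ofReal (H t) * ENNReal.ofReal (1 / H t) ∂ν :=
          lintegral_withDensity_eq_lintegral_mul _ hHo (measurable_const.div hHm).ennreal_ofReal
      _ = ∫⁻ _ in Ioo p q, 1 ∂ν := setLIntegral_congr_fun hIm fun t ht => by
          rw [← ENNReal.ofReal_mul (hH0 t ht).le, mul_one_div_cancel (hH0 t ht).ne',
            ENNReal.ofReal_one]
      _ = ν (Ioo p q) := setLIntegral_one _
  rw [integral_eq_lintegral_of_nonneg_ae
    ((ae_restrict_mem hIm).mono fun t ht => (one_div_pos.2 (hH0 t ht)).le)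
    (measurable_const.div hHm).aestronglyMeasurable]
  have := ENNReal.toReal_mono (measure_ne_top _ _) hlint
  rwa [ENNReal.toReal_mul, ENNReal.toReal_ofReal hc] at this

/-- A discrete Grönwall-type lower bound. -/
theorem mul_exp_integral_le {g k : ℝ → ℝ} {a b : ℝ} (hab : a ≤ b)
    (hk : IntervalIntegrable k volume a b) (hk0 : ∀ t ∈ Icc a b, 0 ≤ k t)
    (hg0 : ∀ t, 0 ≤ g t)
    (h : ∀ s t, a ≤ s → s ≤ t → t ≤ b → g s * (1 + ∫ r in s..t, k r) ≤ g t) :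
    g a * Real.exp (∫ t in a..b, k t) ≤ g b := by
  set κ : ℝ → ℝ := fun t => ∫ r in a..t, k r with hκ
  have hsub {s t : ℝ} (hs : a ≤ s) (hst : s ≤ t) (ht : t ≤ b) :
      IntervalIntegrable k volume s t := by
    refine hk.mono_set ?_
    rw [uIcc_of_le hst, uIcc_of_le hab]
    exact Icc_subset_Icc hs ht
  have hint0 {s t : ℝ} (hs : a ≤ s) (hst : s ≤ t) (ht : t ≤ b) : 0 ≤ ∫ r in s..t, k r :=
    intervalIntegral.integral_nonneg hst fun r hr => hk0 r ⟨hs.trans hr.1, hr.2.trans ht⟩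
  have hadd {s t : ℝ} (hs : a ≤ s) (hst : s ≤ t) (ht : t ≤ b) :
      κ s + ∫ r in s..t, k r = κ t :=
    intervalIntegral.integral_add_adjacent_intervals (hsub le_rfl hs (hst.trans ht))
      (hsub hs hst ht)
  have hκcont : ContinuousOn κ (Icc a b) := by
    rw [← uIcc_of_le hab]
    exact intervalIntegral.continuousOn_primitive_interval' hk left_mem_uIcc
  have hκb : 0 ≤ κ b := hint0 le_rfl hab le_rfl
  have hpow (N : ℕ) (hN : 0 < N) : g a * (1 + κ b / N) ^ N ≤ g b := by
    have hN' : (0 : ℝ) < N := by exact_mod_cast hN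
    have hstep (m : ℕ) (hm : m ≤ N) :
        ∃ t ∈ Icc a b, κ t = m / N * κ b ∧ g a * (1 + κ b / N) ^ m ≤ g t := by
      induction m with
      | zero => exact ⟨a, left_mem_Icc.2 hab, by simp [hκ], by simp⟩
      | succ m ih =>
        obtain ⟨s, hs, hsκ, hsg⟩ := ih (Nat.le_of_succ_le hm)
        have hmN : ((m + 1 : ℕ) : ℝ) / N ≤ 1 := (div_le_one hN').2 (by exact_mod_cast hm)
        have hmem : ((m + 1 : ℕ) : ℝ) / N * κ b ∈ Icc (κ s) (κ b) := by
          refine ⟨?_, mul_le_of_le_one_left hκb hmN⟩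
          rw [hsκ]
          gcongr
          exact Nat.le_succ m
        obtain ⟨t, ht, htκ⟩ := intermediate_value_Icc hs.2
          (hκcont.mono (Icc_subset_Icc_left hs.1)) hmem
        refine ⟨t, ⟨hs.1.trans ht.1, ht.2⟩, htκ, ?_⟩
        have hst : ∫ r in s..t, k r = κ b / N := by
          have := hadd hs.1 ht.1 ht.2
          rw [htκ, hsκ] at this
          push_cast at this
          linear_combination this
        have hgt := h s t hs.1 ht.1 ht.2
        rw [hst] at hgt
        calc g a * (1 + κ b / N) ^ (m + 1) = g a * (1 + κ b / N) ^ m * (1 + κ b / N) := by ring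
          _ ≤ g s * (1 + κ b / N) := by gcongr
          _ ≤ g t := hgt
    obtain ⟨t, ht, -, htg⟩ := hstep N le_rfl
    have h1 := h t b ht.1 ht.2 le_rfl
    have h2 := mul_nonneg (hg0 t) (hint0 ht.1 ht.2 le_rfl)
    linarith
  refine le_of_tendsto ((Real.tendsto_one_add_div_pow_exp (κ b)).const_mul (g a)) ?_
  filter_upwards [eventually_gt_atTop 0] with N hN using hpow N hN

end OneDimensional

section AntiLyapunov

variable {n : ℕ}

theorem notMem_closure_sublevel_of_lt {𝒰 : Set (Eucl n)} (hUopen : IsOpen 𝒰) {U : Eucl n → ℝ}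
    (hU : ContinuousOn U 𝒰) {r : ℝ} {x : Eucl n} (hx : x ∈ 𝒰) (hrx : r < U x) :
    x ∉ closure {y ∈ 𝒰 | U y < r} := by
  have h : 𝒰 ∩ U ⁻¹' Ioi r ∈ 𝓝 x :=
    (hU.isOpen_inter_preimage hUopen isOpen_Ioi).mem_nhds ⟨hx, hrx⟩
  intro hcl
  obtain ⟨y, hy, hy'⟩ := mem_closure_iff_nhds.1 hcl _ h
  exact lt_asymm hy.2 hy'.2

/-- The stationary mass of `{s < U < p}` is controlled by the flux through `{p < U < q}`. -/
theorem mul_integral_le_integral_comp_mul {𝒰 : Set (Eucl n)} (hUopen : IsOpen 𝒰)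
    {a : Eucl n → Matrix (Fin n) (Fin n) ℝ} {V : Eucl n → Fin n → ℝ} {u : Eucl n → ℝ}
    (ha : ∀ i j, ContinuousOn (fun x => a x i j) 𝒰)
    (ha_psd : ∀ x ∈ 𝒰, ∀ v : Fin n → ℝ, 0 ≤ ∑ i, ∑ j, a x i j * v i * v j)
    (hV : ContinuousOn V 𝒰) (hu : ContinuousOn u 𝒰) (hu0 : ∀ x ∈ 𝒰, 0 ≤ u x)
    (hui : IntegrableOn u 𝒰)
    (hu_stat : ∀ f : Eucl n → ℝ, ContDiff ℝ (⊤ : ℕ∞) f → HasCompactSupport f →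
      tsupport f ⊆ 𝒰 → (∫ x in 𝒰, Lop a V f x * u x) = 0)
    {U : Eucl n → ℝ} (hU : ContDiffOn ℝ 2 U 𝒰) {r s p q γ M : ℝ}
    (hrs : r < s) (hsp : s < p) (hpq : p < q) (hγ : 0 ≤ γ)
    (hq : IsCompact {x ∈ 𝒰 | U x ≤ q})
    (hAnti : ∀ x ∈ 𝒰, r < U x → γ ≤ Lop a V U x)
    {H : ℝ → ℝ} (hHm : Measurable H) (hH_up : ∀ x ∈ 𝒰, aQuad a U x ≤ H (U x))
    (hH0 : ∀ t ∈ Ioo p q, 0 ≤ H t) (hHM : ∀ t ∈ Ioo p q, H t ≤ M)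
    {w : ℝ → ℝ} (hw : Continuous w) (hw0 : ∀ t, 0 ≤ w t) (hws : ∀ t, t ∉ Ioo p q → w t = 0) :
    γ * (∫ t, w t) * ∫ x in 𝒰, u x * (Ioo s p).indicator 1 (U x) ≤
      ∫ x in 𝒰, u x * (w (U x) * H (U x)) := by
  set m := ∫ t, w t with hm
  have hm0 : 0 ≤ m := integral_nonneg hw0
  obtain ⟨W, hW, hWp, hWq, hWb⟩ := exists_primitive_of_support_subset_Ioo hpq.le hw hw0 hws
  let bump : ContDiffBump ((r + s) / 2) :=
    ⟨(s - r) / 4, (s - r) / 2, by linarith, by linarith⟩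
  set η : ℝ → ℝ := bump.normed volume with hη
  have hη0 (t : ℝ) : 0 ≤ η t := bump.nonneg_normed t
  have hηc : Continuous η := bump.continuous_normed
  have hη1 : ∫ t, η t = 1 := bump.integral_normed
  have hηs (t : ℝ) (ht : t ∉ Ioo r s) : η t = 0 := by
    by_contra h
    have h' : t ∈ Function.support η := h
    rw [hη, bump.support_normed_eq, Real.ball_eq_Ioo] at h'
    refine ht ⟨?_, ?_⟩
    · have := h'.1
      simp only [bump] at this
      linarith
    · have := h'.2
      simp only [bump] at this
      linarith
  obtain ⟨E, hE, hEr, hEs, hEb⟩ := exists_primitive_of_support_subset_Ioo hrs.le hηc hη0 hηs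
  rw [hη1] at hEs hEb
  let ζ (t : ℝ) : ℝ := m * η t - w t
  let ψ (t : ℝ) : ℝ := m * E t - W t
  have hζc : Continuous ζ := (continuous_const.mul hηc).sub hw
  have hψ (t : ℝ) : HasDerivAt ψ (ζ t) t := ((hE t).const_mul m).sub (hW t)
  have hψc : Continuous ψ := continuous_iff_continuousAt.2 fun t => (hψ t).continuousAt
  have hψr (t : ℝ) (ht : t ≤ r) : ψ t = 0 := by
    simp only [ψ, hEr t ht, hWp t (ht.trans (hrs.trans hsp).le)]
    ring
  have hψq (t : ℝ) (ht : q ≤ t) : ψ t = 0 := by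
    simp only [ψ, hEs t ((hsp.trans hpq).le.trans ht), hWq t ht, hm]
    ring
  have hψm (t : ℝ) (ht : t ∈ Ioo s p) : ψ t = m := by
    simp only [ψ, hEs t ht.1.le, hWp t ht.2.le]
    ring
  have hψ0 (t : ℝ) : 0 ≤ ψ t := by
    simp only [ψ]
    rcases le_total t s with h | h
    · rw [hWp t (h.trans hsp.le), sub_zero]
      exact mul_nonneg hm0 (hEb t).1
    · rw [hEs t h]
      linarith [(hWb t).2]
  let φ (t : ℝ) : ℝ := ∫ τ in q..t, ψ τ
  have hφ (t : ℝ) : HasDerivAt φ (ψ t) t :=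
    intervalIntegral.integral_hasDerivAt_right (hψc.intervalIntegrable _ _)
      hψc.aestronglyMeasurable.stronglyMeasurableAtFilter hψc.continuousAt
  have hφq (t : ℝ) (ht : q ≤ t) : φ t = 0 := by
    refine intervalIntegral.integral_zero_ae (Eventually.of_forall fun τ hτ => hψq τ ?_)
    rw [uIoc_of_le ht] at hτ
    exact hτ.1.le
  obtain ⟨hint, hzero⟩ :=
    integral_comp_eq_zero hUopen ha hV hu hu_stat hU hq hφ hψ hζc hφq
  have hUm : AEMeasurable U (volume.restrict 𝒰) := hU.continuousOn.aemeasurable hUopen.measurableSet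
  obtain ⟨C, hC⟩ := isCompact_Icc.exists_bound_of_continuousOn (s := Icc p q) hw.continuousOn
  have hC0 : 0 ≤ C := (norm_nonneg _).trans (hC p (left_mem_Icc.2 hpq.le))
  have hwH (t : ℝ) : ‖w t * H t‖ ≤ C * |M| := by
    by_cases ht : t ∈ Ioo p q
    · rw [norm_mul]
      refine mul_le_mul (hC t (Ioo_subset_Icc_self ht)) ?_ (norm_nonneg _) hC0
      rw [Real.norm_eq_abs, abs_of_nonneg (hH0 t ht)]
      exact (hHM t ht).trans (le_abs_self M)
    · rw [hws t ht, zero_mul, norm_zero]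
      positivity
  have hint1 : IntegrableOn (fun x => u x * (w (U x) * H (U x))) 𝒰 :=
    hui.mul_bdd (c := C * |M|)
      ((hw.measurable.mul hHm).comp_aemeasurable hUm).aestronglyMeasurable
      (Eventually.of_forall fun x => hwH (U x))
  have hint2 : IntegrableOn (fun x => u x * (Ioo s p).indicator 1 (U x)) 𝒰 :=
    hui.mul_bdd (c := 1) (((measurable_one.indicator measurableSet_Ioo).comp_aemeasurable
      hUm).aestronglyMeasurable) (Eventually.of_forall fun x => by
        by_cases h : U x ∈ Ioo s p <;> simp [h])
  have key : ∫ x in 𝒰, (γ * m * (u x * (Ioo s p).indicator 1 (U x)) -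
      u x * (w (U x) * H (U x))) ≤ 0 := by
    rw [← hzero]
    refine setIntegral_mono_on ((hint2.const_mul _).sub hint1) hint hUopen.measurableSet
      fun x hx => ?_
    have hA0 : 0 ≤ aQuad a U x := ha_psd x hx fun i => pd U i x
    have h1 : γ * ψ (U x) ≤ ψ (U x) * Lop a V U x := by
      rcases le_or_gt (U x) r with h | h
      · rw [hψr _ h, mul_zero, zero_mul]
      · rw [mul_comm γ]
        exact mul_le_mul_of_nonneg_left (hAnti x hx h) (hψ0 _)
    have h2 : -(w (U x) * H (U x)) ≤ ζ (U x) * aQuad a U x := by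
      have h3 := mul_le_mul_of_nonneg_left (hH_up x hx) (hw0 (U x))
      have h4 := mul_nonneg (mul_nonneg hm0 (hη0 (U x))) hA0
      simp only [ζ]
      linarith
    have h3 : γ * m * (Ioo s p).indicator 1 (U x) ≤ γ * ψ (U x) := by
      by_cases h : U x ∈ Ioo s p
      · simp [h, hψm _ h]
      · simpa [h] using mul_nonneg hγ (hψ0 (U x))
    have h4 := mul_le_mul_of_nonneg_right (add_le_add (h3.trans h1) h2) (hu0 x hx)
    linarith
  rw [integral_sub (hint2.const_mul _) hint1, integral_const_mul] at key
  linarith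

end AntiLyapunov

section LevelMeasure

variable {n : ℕ}

/-- The distribution of `U` under the measure on `𝒰` with density `u`. -/
def levelMeasure (𝒰 : Set (Eucl n)) (u U : Eucl n → ℝ) : Measure ℝ :=
  ((volume.restrict 𝒰).withDensity fun x => ENNReal.ofReal (u x)).map U

variable {𝒰 : Set (Eucl n)} {u U : Eucl n → ℝ}

theorem isFiniteMeasure_levelMeasure (hui : IntegrableOn u 𝒰) :
    IsFiniteMeasure (levelMeasure 𝒰 u U) := by
  have := isFiniteMeasure_withDensity_ofReal hui.hasFiniteIntegral
  rw [levelMeasure]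
  infer_instance

theorem integral_levelMeasure (h𝒰 : MeasurableSet 𝒰) (hu0 : ∀ x ∈ 𝒰, 0 ≤ u x)
    (hui : IntegrableOn u 𝒰) (hU : ContinuousOn U 𝒰) {g : ℝ → ℝ} (hg : Measurable g) :
    ∫ t, g t ∂levelMeasure 𝒰 u U = ∫ x in 𝒰, u x * g (U x) := by
  have hUm : AEMeasurable U ((volume.restrict 𝒰).withDensity fun x => ENNReal.ofReal (u x)) :=
    (hU.aemeasurable h𝒰).mono_ac (withDensity_absolutelyContinuous _ _)
  rw [levelMeasure, integral_map hUm hg.aestronglyMeasurable,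
    integral_withDensity_eq_integral_toReal_smul₀ hui.aemeasurable.ennreal_ofReal
      (Eventually.of_forall fun _ => ENNReal.ofReal_lt_top)]
  refine setIntegral_congr_fun h𝒰 fun x hx => ?_
  simp only [smul_eq_mul, ENNReal.toReal_ofReal (hu0 x hx)]

theorem levelMeasure_real_Ioo (h𝒰 : IsOpen 𝒰) (hu0 : ∀ x ∈ 𝒰, 0 ≤ u x)
    (hui : IntegrableOn u 𝒰) (hU : ContinuousOn U 𝒰) (s t : ℝ) :
    (levelMeasure 𝒰 u U).real (Ioo s t) = ∫ x in {x ∈ 𝒰 | s < U x ∧ U x < t}, u x := by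
  have hS : MeasurableSet {x ∈ 𝒰 | s < U x ∧ U x < t} :=
    (hU.isOpen_inter_preimage h𝒰 (isOpen_Ioo (a := s) (b := t))).measurableSet
  rw [← integral_indicator_one measurableSet_Ioo,
    integral_levelMeasure h𝒰.measurableSet hu0 hui hU (measurable_one.indicator measurableSet_Ioo),
    ← integral_indicator h𝒰.measurableSet, ← integral_indicator hS]
  refine integral_congr_ae (Eventually.of_forall fun x => ?_)
  by_cases hx : x ∈ 𝒰 <;> by_cases ht : s < U x ∧ U x < t <;> simp [hx, ht, indicator]

theorem mul_measureReal_Ioo_le_of_forall_lt {ν : Measure ℝ} [IsFiniteMeasure ν] {r p c R : ℝ}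
    (hrp : r < p) (h : ∀ s, r < s → s < p → c * ν.real (Ioo s p) ≤ R) :
    c * ν.real (Ioo r p) ≤ R := by
  obtain ⟨s, hs, hsm, hslim⟩ := exists_seq_strictAnti_tendsto' hrp
  have hmono : Monotone fun k => Ioo (s k) p := fun i j hij =>
    Ioo_subset_Ioo_left (hs.antitone hij)
  have hUn : ⋃ k, Ioo (s k) p = Ioo r p := by
    ext t
    simp only [mem_iUnion, mem_Ioo]
    constructor
    · rintro ⟨k, hk⟩
      exact ⟨(hsm k).1.trans hk.1, hk.2⟩
    · rintro ⟨h1, h2⟩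
      obtain ⟨k, hk⟩ := (hslim.eventually_lt_const h1).exists
      exact ⟨k, hk, h2⟩
  have hlim := (ENNReal.tendsto_toReal (measure_ne_top ν _)).comp
    (tendsto_measure_iUnion_atTop (μ := ν) hmono)
  rw [hUn] at hlim
  exact le_of_tendsto' (hlim.const_mul c) fun k => h (s k) (hsm k).1 (hsm k).2

end LevelMeasure

/-- **Theorem B(a)**. -/
theorem thmB_a
    {n : ℕ} (hn : 0 < n)
    (𝒰 : Set (Eucl n)) (hUopen : IsOpen 𝒰) (hUconn : IsConnected 𝒰)
    (a : Eucl n → Matrix (Fin n) (Fin n) ℝ)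
    (ha_C1 : ∀ i j, ContDiffOn ℝ 1 (fun x => a x i j) 𝒰)
    (ha_symm : ∀ x ∈ 𝒰, ∀ i j, a x i j = a x j i)
    (ha_psd : ∀ x ∈ 𝒰, ∀ v : Fin n → ℝ, 0 ≤ ∑ i, ∑ j, a x i j * v i * v j)
    (V : Eucl n → Fin n → ℝ) (hV_cont : ContinuousOn V 𝒰)
    (u : Eucl n → ℝ) (hu_C1 : ContDiffOn ℝ 1 u 𝒰) (hu_nonneg : ∀ x ∈ 𝒰, 0 ≤ u x)
    (hu_mass : (∫ x in 𝒰, u x) = 1)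
    (hu_stat : ∀ f : Eucl n → ℝ, ContDiff ℝ (⊤ : ℕ∞) f → HasCompactSupport f →
      tsupport f ⊆ 𝒰 → (∫ x in 𝒰, Lop a V f x * u x) = 0)
    (U : Eucl n → ℝ) (ρM : EReal) (hU_C2 : ContDiffOn ℝ 2 U 𝒰)
    (hU_nonneg : ∀ x ∈ 𝒰, 0 ≤ U x)
    (hU_lt : ∀ x ∈ 𝒰, (U x : EReal) < ρM)
    (hU_sup : ρM = ⨆ x : 𝒰, (U x.1 : EReal))
    (hU_cpt : ∀ ρ : ℝ, (ρ : EReal) < ρM → IsCompact {x ∈ 𝒰 | U x ≤ ρ})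
    (ρm γ : ℝ) (hρm_pos : 0 < ρm) (hρm_lt : (ρm : EReal) < ρM) (hγ : 0 < γ)
    (hAnti : ∀ x ∈ 𝒰, x ∉ closure {y ∈ 𝒰 | U y < ρm} → γ ≤ Lop a V U x)
    (H : ℝ → ℝ) (hH_meas : Measurable H)
    (hH_nonneg : ∀ t : ℝ, 0 ≤ t → (t : EReal) < ρM → 0 ≤ H t)
    (hH_locbdd : ∀ ρ : ℝ, (ρ : EReal) < ρM → BddAbove (H '' Set.Icc 0 ρ))
    (hH_up : ∀ x ∈ 𝒰, aQuad a U x ≤ H (U x))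
    (hH_pos : ∀ t : ℝ, ρm ≤ t → (t : EReal) < ρM → 0 < H t)
    (hR : ∀ᵐ r ∂(volume.restrict {t : ℝ | ρm ≤ t ∧ (t : EReal) < ρM}),
      ∀ x ∈ 𝒰, U x = r → gradient U x ≠ 0)
    :
    ∀ ρ0 ρ : ℝ, ρm < ρ0 → ρ0 < ρ → (ρ : EReal) < ρM →
      (∫ x in {x ∈ 𝒰 | ρm < U x ∧ U x < ρ0}, u x) *
          Real.exp (γ * ∫ t in ρ0..ρ, 1 / H t) ≤
        ∫ x in {x ∈ 𝒰 | ρm < U x ∧ U x < ρ}, u x := by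
  intro ρ0 ρ hρ0 hρ hρM
  have haC (i j : Fin n) : ContinuousOn (fun x => a x i j) 𝒰 := (ha_C1 i j).continuousOn
  have huC : ContinuousOn u 𝒰 := hu_C1.continuousOn
  have hUC : ContinuousOn U 𝒰 := hU_C2.continuousOn
  have hui : IntegrableOn u 𝒰 := by
    by_contra h
    rw [integral_undef h] at hu_mass
    exact zero_ne_one hu_mass
  set ν := levelMeasure 𝒰 u U with hν
  have hνfin : IsFiniteMeasure ν := isFiniteMeasure_levelMeasure hui
  obtain ⟨M, hM⟩ := hH_locbdd ρ hρM
  have hHM (t : ℝ) (h0 : 0 ≤ t) (ht : t ≤ ρ) : H t ≤ M := hM ⟨t, ⟨h0, ht⟩, rfl⟩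
  have hlt (t : ℝ) (ht : t ≤ ρ) : (t : EReal) < ρM := (EReal.coe_le_coe_iff.2 ht).trans_lt hρM
  have hHpos (t : ℝ) (h0 : ρm ≤ t) (ht : t ≤ ρ) : 0 < H t := hH_pos t h0 (hlt t ht)
  have hAnti' (x : Eucl n) (hx : x ∈ 𝒰) (h : ρm < U x) : γ ≤ Lop a V U x :=
    hAnti x hx (notMem_closure_sublevel_of_lt hUopen hUC hx h)
  rw [← levelMeasure_real_Ioo hUopen hu_nonneg hui hUC,
    ← levelMeasure_real_Ioo hUopen hu_nonneg hui hUC, ← hν, ← intervalIntegral.integral_const_mul]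
  have hflux (p q : ℝ) (hp : ρm < p) (hpq : p < q) (hq : q ≤ ρ) :
      γ * ν.real (Ioo ρm p) * ∫ t in Ioo p q, 1 / H t ≤ ν.real (Ioo p q) := by
    refine mul_integral_one_div_le (M := M) hH_meas (mul_nonneg hγ.le measureReal_nonneg)
      (fun t ht => hHpos t (hp.trans ht.1).le (ht.2.le.trans hq))
      (fun t ht => hHM t (hρm_pos.trans (hp.trans ht.1)).le (ht.2.le.trans hq))
      fun w hw hw0 hws => ?_
    rw [mul_right_comm]
    refine mul_measureReal_Ioo_le_of_forall_lt hp fun s hs hsp => ?_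
    rw [← integral_indicator_one measurableSet_Ioo,
      integral_levelMeasure hUopen.measurableSet hu_nonneg hui hUC
        (measurable_one.indicator measurableSet_Ioo),
      integral_levelMeasure hUopen.measurableSet hu_nonneg hui hUC (g := fun t => w t * H t)
        (hw.measurable.mul hH_meas)]
    exact mul_integral_le_integral_comp_mul (M := M) hUopen haC ha_psd hV_cont huC hu_nonneg hui
      hu_stat hU_C2 hs hsp hpq hγ.le (hU_cpt q (hlt q hq)) hAnti' hH_meas hH_up
      (fun t ht => (hHpos t (hp.trans ht.1).le (ht.2.le.trans hq)).le)
      (fun t ht => hHM t (hρm_pos.trans (hp.trans ht.1)).le (ht.2.le.trans hq)) hw hw0 hws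
  by_cases hk : IntervalIntegrable (fun t => γ * (1 / H t)) volume ρ0 ρ
  · refine mul_exp_integral_le (g := fun t => ν.real (Ioo ρm t)) hρ.le hk
      (fun t ht => ?_) (fun _ => measureReal_nonneg) fun s t hs hst ht => ?_
    · have := hHpos t (hρ0.le.trans ht.1) ht.2
      positivity
    · rcases hst.eq_or_lt with rfl | hst
      · simp
      · have h1 := hflux s t (hρ0.trans_le hs) hst ht
        have h2 : ν.real (Ioo ρm s) + ν.real (Ioo s t) ≤ ν.real (Ioo ρm t) := by
          rw [← measureReal_union (Set.disjoint_left.2 fun x hx hx' => lt_asymm hx.2 hx'.1)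
            measurableSet_Ioo]
          exact measureReal_mono (union_subset (Ioo_subset_Ioo_right hst.le)
            (Ioo_subset_Ioo_left (hρ0.trans_le hs).le))
        rw [intervalIntegral.integral_const_mul, intervalIntegral.integral_of_le hst.le,
          integral_Ioc_eq_integral_Ioo]
        linarith
  · rw [intervalIntegral.integral_undef hk, Real.exp_zero, mul_one]
    exact measureReal_mono (Ioo_subset_Ioo_right hρ.le)
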